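/- For every real q > 1: [ (q − 1)(q + 1)(q⁴ + 2q³ + q² − 2q^{3/2} + 1) / ( q (q^{5/2} + q^{3/2} − 1)² ) ] · ( 1 + q/((q+1)(q^{3/2} − 1)) )² = 1 − 1/(q(q+1)) + 2q/((q+1)(q^{3/2} − 1)). Consequently, the Euler product 𝒫₁ := ∏_{𝔭 prime ideal of ℤ[ω], 𝔭 ∤ 3, q := N(𝔭)} [ (q−1)(q+1)(q⁴+2q³+q²−2q^{3/2}+1) / ( q (q^{5/2}+q^{3/2}−1)² ) ] · ( 1 + q/((q+1)(q^{3/2}−1)) )² · ( 1 − 1/(q(q+1)) + 2q/((q+1)(q^{3/2}−1)) )^{−1} equals 1. -/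

import Mathlib

noncomputable section

open Complex

namespace CubicPaper

/-- `ω = e^{2πi/3}`. -/
def ωc : ℂ := Complex.exp (2 * Real.pi * Complex.I / 3)

/-- The ring of Eisenstein integers `ℤ[ω]`, realized as a subring of `ℂ`. -/
def Eis : Subring ℂ := Subring.closure {ωc}

/-- `ω` as an Eisenstein integer. -/
def ωE : Eis := ⟨ωc, Subring.subset_closure (Set.mem_singleton _)⟩

/-- The ramified prime `λ = 1 + 2ω`. -/
def lam : Eis := 1 + 2 * ωE

/-- The norm `N(x) = |x|²`. -/
def Nm (x : Eis) : ℝ := Complex.normSq (x : ℂ)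

/-- The norm as a natural number. -/
def NmN (x : Eis) : ℕ := ⌊Nm x⌋₊

/-- `Rep x` : `x` is the canonical generator `λ^k c`, `c ≡ 1 (mod 3)`, of a nonzero ideal;
nonzero ideals of `ℤ[ω]` are in bijection with elements satisfying `Rep`. -/
def Rep (x : Eis) : Prop := ∃ (k : ℕ) (c : Eis), (3 : Eis) ∣ (c - 1) ∧ x = lam ^ k * c

/-- `ě(z) = e^{2πi(z + z̄)}`. -/
def eE (z : ℂ) : ℂ := Complex.exp (2 * Real.pi * Complex.I * (z + (starRingEnd ℂ) z))

/-- Characterizing axioms of the cubic residue symbol; `χ b a` denotes `(a/b)₃`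
(the lower entry `b ≡ 1 (mod 3)` comes first). -/
structure IsCubicSymbol (χ : Eis → Eis → Eis) : Prop where
  one_bot : ∀ a, χ 1 a = 1
  mul_bot : ∀ b₁ b₂ a, (3 : Eis) ∣ (b₁ - 1) → (3 : Eis) ∣ (b₂ - 1) →
    χ (b₁ * b₂) a = χ b₁ a * χ b₂ a
  prime_vals : ∀ π a, Prime π → (3 : Eis) ∣ (π - 1) →
    χ π a = 0 ∨ χ π a = 1 ∨ χ π a = ωE ∨ χ π a = ωE ^ 2
  prime_congr : ∀ π a, Prime π → (3 : Eis) ∣ (π - 1) →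
    π ∣ (a ^ ((NmN π - 1) / 3) - χ π a)
  prime_eq_zero : ∀ π a, Prime π → (3 : Eis) ∣ (π - 1) → (χ π a = 0 ↔ π ∣ a)

/-- Characterizing axioms of the Möbius function on `ℤ[ω]`. -/
structure IsMoebius (μ : Eis → ℤ) : Prop where
  isUnit : ∀ u : Eis, IsUnit u → μ u = 1
  prime_mul : ∀ p x, Prime p → ¬ p ∣ x → μ (p * x) = - μ x
  eq_zero : ∀ x : Eis, ¬ Squarefree x → μ x = 0

/-- The cubic Gauss sum `g₃(m, c) = ∑_{d mod c} χ_c(d) ě(md/c)`. -/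
def g₃ (χ : Eis → Eis → Eis) (m c : Eis) : ℂ :=
  ∑ᶠ d : Eis ⧸ Ideal.span {c}, ((χ c d.out : Eis) : ℂ) * eE (((m * d.out : Eis) : ℂ) / (c : ℂ))

/-- The normalized cubic Gauss sum `g̃₃(m, c) = N(c)^{-1/2} g₃(m, c)`. -/
def g₃n (χ : Eis → Eis → Eis) (m c : Eis) : ℂ :=
  ((Real.sqrt (Nm c) : ℂ))⁻¹ * g₃ χ m c

/-- Euler's totient on `ℤ[ω]`. -/
def phiE (b : Eis) : ℕ := Nat.card {x : Eis ⧸ Ideal.span {b} // IsUnit x}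

/-- The kernel `Φ_j(y) = (1/2πi)∫_{(2)} (2π)^{-jw} y^{-w} (Γ(1/2+w)/Γ(1/2))^j dw/w`. -/
def Φ (j : ℕ) (y : ℝ) : ℂ :=
  (1 / (2 * Real.pi)) * ∫ t : ℝ,
    (2 * Real.pi : ℂ) ^ (-((j : ℂ) * (2 + t * Complex.I))) *
    (y : ℂ) ^ (-(2 + t * Complex.I)) *
    (Complex.Gamma (1 / 2 + (2 + t * Complex.I)) / Complex.Gamma (1 / 2)) ^ j /
    (2 + t * Complex.I)

/-- `A₁(q)`, the sum appearing in the approximate functional equation for `L(1/2, χ_q)`. -/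
def A₁ (χ : Eis → Eis → Eis) (q : Eis) : ℂ :=
  ∑' n : {x : Eis // Rep x},
    ((χ q n.1 : Eis) : ℂ) * (Nm n.1 : ℂ) ^ (-(1/2 : ℂ)) *
      Φ 1 (Nm n.1 / Real.sqrt (3 * Nm q))

/-- `A₂(q)`, the double sum appearing in the approximate functional equation for
`|L(1/2, χ_q)|²`. -/
def A₂ (χ : Eis → Eis → Eis) (q : Eis) : ℂ :=
  ∑' p : {x : Eis // Rep x} × {x : Eis // Rep x},
    ((χ q p.1.1 : Eis) : ℂ) * (starRingEnd ℂ) ((χ q p.2.1 : Eis) : ℂ) *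
      ((Nm p.1.1 * Nm p.2.1 : ℝ) : ℂ) ^ (-(1/2 : ℂ)) *
      Φ 2 (Nm p.1.1 * Nm p.2.1 / (3 * Nm q))

/-- `M_Y(q) = ∑_{𝔩² ∣ q, N(𝔩) ≤ Y} μ(𝔩)` (sum over nonzero ideals `𝔩`, i.e. over
canonical generators). -/
def MY (μ : Eis → ℤ) (Y : ℝ) (q : Eis) : ℤ :=
  ∑ᶠ l ∈ {l : Eis | Rep l ∧ l ^ 2 ∣ q ∧ Nm l ≤ Y}, μ l

/-- `R_Y(q) = ∑_{𝔩² ∣ q, N(𝔩) > Y} μ(𝔩)`. -/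
def RY (μ : Eis → ℤ) (Y : ℝ) (q : Eis) : ℤ :=
  ∑ᶠ l ∈ {l : Eis | Rep l ∧ l ^ 2 ∣ q ∧ Y < Nm l}, μ l

/-- The mollifier `𝓜(q) = ∑_𝔟 λ(𝔟) √N(𝔟) χ_q(𝔟)` attached to coefficients `lm`
(supported on canonical generators of squarefree ideals coprime to 3). -/
def Moll (χ : Eis → Eis → Eis) (lm : Eis → ℂ) (q : Eis) : ℂ :=
  ∑ᶠ b : Eis, lm b * (Real.sqrt (Nm b) : ℂ) * ((χ q b : Eis) : ℂ)

/-- `𝒮_M(β; F) = ∑_{q ≡ 1 (9)} M_Y(q) β_q F(N(q)/X)`. -/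
def SM (μ : Eis → ℤ) (Y X : ℝ) (F : ℝ → ℝ) (β : Eis → ℂ) : ℂ :=
  ∑ᶠ q ∈ {q : Eis | (9 : Eis) ∣ (q - 1)}, (MY μ Y q : ℂ) * β q * (F (Nm q / X) : ℂ)

/-- `𝒮_R(|β|; F) = ∑_{q ≡ 1 (9)} |R_Y(q)| ‖β_q‖ F(N(q)/X)`. -/
def SR (μ : Eis → ℤ) (Y X : ℝ) (F : ℝ → ℝ) (β : Eis → ℂ) : ℝ :=
  ∑ᶠ q ∈ {q : Eis | (9 : Eis) ∣ (q - 1)}, |(RY μ Y q : ℝ)| * ‖β q‖ * F (Nm q / X)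

/-- A test function: Schwartz (here: smooth), compactly supported in `(1,2)`,
with `0 ≤ F ≤ 1`. -/
structure IsTestFn (F : ℝ → ℝ) : Prop where
  smooth : ContDiff ℝ (⊤ : ℕ∞) F
  supp : ∀ t, F t ≠ 0 → 1 < t ∧ t < 2
  nonneg : ∀ t, 0 ≤ F t
  le_one : ∀ t, F t ≤ 1

/-- `F̌(0) = ∫₀^∞ F(t) dt`. -/
def Fcheck0 (F : ℝ → ℝ) : ℝ := ∫ t in Set.Ioi (0:ℝ), F t

/-- `F̌'(0) = ∫₀^∞ F(t) log t dt`. -/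
def Fcheck'0 (F : ℝ → ℝ) : ℝ := ∫ t in Set.Ioi (0:ℝ), F t * Real.log t

/-- The Dedekind zeta function of `ℚ(ω)` (at real `s > 1`). -/
def zetaK (s : ℝ) : ℝ := ∑' n : {x : Eis // Rep x}, (Nm n.1) ^ (-s)

/-- Product of `f(N(𝔭))` over the prime ideals `𝔭 ∤ 3` of `ℤ[ω]`, i.e. over primes
`π ≡ 1 (mod 3)` (one in each associate class). -/
def primeProd (f : ℝ → ℝ) : ℝ :=
  ∏' π : {p : Eis // Prime p ∧ (3 : Eis) ∣ (p - 1)}, f (Nm π.1)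

/-- Product of `f(N(𝔭))` over the prime ideals `𝔭 ∤ 3` dividing `x` (a finite product). -/
def primeDivProd (f : ℝ → ℝ) (x : Eis) : ℝ :=
  ∏ᶠ π ∈ {p : Eis | Prime p ∧ (3 : Eis) ∣ (p - 1) ∧ p ∣ x}, f (Nm π)

/-- The Hecke `L`-series `∑_𝔫 χ_q(𝔫) N(𝔫)^{-s}` (convergent for `Re(s) > 1`). -/
def heckeSeries (χ : Eis → Eis → Eis) (q : Eis) (s : ℂ) : ℂ :=
  ∑' n : {x : Eis // Rep x}, ((χ q n.1 : Eis) : ℂ) * (Nm n.1 : ℂ) ^ (-s)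

/-- `L` is the (unique) entire continuation of the Hecke `L`-series of `χ_q`. -/
def IsHeckeL (χ : Eis → Eis → Eis) (q : Eis) (L : ℂ → ℂ) : Prop :=
  Differentiable ℂ L ∧ ∀ s : ℂ, 1 < s.re → L s = heckeSeries χ q s

/-- Membership in the family `F₃` of conductors of primitive cubic Hecke characters
congruent to `1 (mod 9)`. -/
def memF₃ (q : Eis) : Prop :=
  ∃ q₁ q₂ : Eis, (3 : Eis) ∣ (q₁ - 1) ∧ (3 : Eis) ∣ (q₂ - 1) ∧ Squarefree (q₁ * q₂) ∧
    NmN (q₁ * q₂ ^ 2) % 9 = 1 ∧ q = q₁ * q₂ ^ 2 ∧ (9 : Eis) ∣ (q - 1) ∧ q ≠ 1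

/-- `ψ_α(r, s) = ∑_{c ≡ 1 (3), (c, α) = 1} g₃(r, c) N(c)^{-s}`. -/
def ψa (χ : Eis → Eis → Eis) (α r : Eis) (s : ℂ) : ℂ :=
  ∑' c : {c : Eis // (3 : Eis) ∣ (c - 1) ∧ IsCoprime c α},
    g₃ χ r c.1 * (Nm c.1 : ℂ) ^ (-s)

/-- `ψ(r, s) = ∑_{c ≡ 1 (3)} g₃(r, c) N(c)^{-s}`. -/
def ψ₀ (χ : Eis → Eis → Eis) (r : Eis) (s : ℂ) : ℂ :=
  ∑' c : {c : Eis // (3 : Eis) ∣ (c - 1)}, g₃ χ r c.1 * (Nm c.1 : ℂ) ^ (-s)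

/-- `Δ_α(s) = ∏_{π ≡ 1 (3) prime, π ∣ α} (1 - N(π)^{2-3s})`. -/
def Δprod (α : Eis) (s : ℂ) : ℂ :=
  ∏ᶠ π ∈ {p : Eis | Prime p ∧ (3 : Eis) ∣ (p - 1) ∧ p ∣ α},
    (1 - (Nm π : ℂ) ^ ((2 : ℂ) - 3 * s))

/-- `Ψ` is the (unique) continuation of `ψ(r, ·)` to the strip `1 < Re(s) < 2`,
holomorphic away from `s = 4/3`. -/
def IsPsiContinuation (χ : Eis → Eis → Eis) (r : Eis) (Ψ : ℂ → ℂ) : Prop :=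
  (∀ s : ℂ, 1 < s.re → s.re < 2 → s ≠ 4/3 → DifferentiableAt ℂ Ψ s) ∧
  (∀ s : ℂ, 3/2 < s.re → s.re < 2 → Ψ s = ψ₀ χ r s)


/-- The local factor of the Euler product `𝒫₁` of Section 8. -/
def P1factor (q : ℝ) : ℝ :=
  ((q - 1) * (q + 1) * (q ^ 4 + 2 * q ^ 3 + q ^ 2 - 2 * q ^ ((3:ℝ)/2) + 1) /
      (q * (q ^ ((5:ℝ)/2) + q ^ ((3:ℝ)/2) - 1) ^ 2)) *
    (1 + q / ((q + 1) * (q ^ ((3:ℝ)/2) - 1))) ^ 2 *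
    (1 - 1 / (q * (q + 1)) + 2 * q / ((q + 1) * (q ^ ((3:ℝ)/2) - 1)))⁻¹

lemma ωc_re : ωc.re = -1 / 2 := by
  have h : (2 * Real.pi * Complex.I / 3 : ℂ) = ((Real.pi - Real.pi / 3 : ℝ) : ℂ) * Complex.I := by
    push_cast; ring
  rw [ωc, h, Complex.exp_ofReal_mul_I_re, Real.cos_pi_sub, Real.cos_pi_div_three]
  norm_num

lemma ωc_im : ωc.im = Real.sqrt 3 / 2 := by
  have h : (2 * Real.pi * Complex.I / 3 : ℂ) = ((Real.pi - Real.pi / 3 : ℝ) : ℂ) * Complex.I := by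
    push_cast; ring
  rw [ωc, h, Complex.exp_ofReal_mul_I_im, Real.sin_pi_sub, Real.sin_pi_div_three]

lemma ωc_sq : ωc * ωc = -1 - ωc := by
  have h3 : Real.sqrt 3 * Real.sqrt 3 = 3 := Real.mul_self_sqrt (by norm_num)
  apply Complex.ext
  · simp [ωc_re, ωc_im]; linarith
  · simp [ωc_re, ωc_im]; ring

lemma ωc_conj : (starRingEnd ℂ) ωc = -1 - ωc := by
  apply Complex.ext
  · simp [ωc_re]; norm_num
  · simp

lemma Eis_form (x : ℂ) (hx : x ∈ Eis) : ∃ a b : ℤ, x = a + b * ωc := by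
  unfold Eis at hx
  induction hx using Subring.closure_induction with
  | mem x hx => exact ⟨0, 1, by simpa using hx⟩
  | zero => exact ⟨0, 0, by simp⟩
  | one => exact ⟨1, 0, by simp⟩
  | add x y _ _ hx hy =>
    obtain ⟨a, b, rfl⟩ := hx
    obtain ⟨c, d, rfl⟩ := hy
    exact ⟨a + c, b + d, by push_cast; ring⟩
  | neg x _ hx =>
    obtain ⟨a, b, rfl⟩ := hx
    exact ⟨-a, -b, by push_cast; ring⟩
  | mul x y _ _ hx hy =>
    obtain ⟨a, b, rfl⟩ := hx
    obtain ⟨c, d, rfl⟩ := hy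
    refine ⟨a * c - b * d, a * d + b * c - b * d, ?_⟩
    push_cast
    linear_combination (b * d : ℂ) * ωc_sq

lemma Nm_gt_one (p : Eis) (hp : Prime p) : 1 < Nm p := by
  obtain ⟨a, b, hab⟩ := Eis_form p.1 p.2
  have hconj : (p : ℂ) * (((a : Eis) + b * (-1 - ωE) : Eis) : ℂ) = ((Nm p : ℝ) : ℂ) := by
    unfold Nm
    rw [← Complex.mul_conj]
    congr 1
    rw [hab]
    simp [ωc_conj, ωE]
  have hN : Nm p = ((a ^ 2 - a * b + b ^ 2 : ℤ) : ℝ) := by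
    have : ((Nm p : ℝ) : ℂ) = (((a ^ 2 - a * b + b ^ 2 : ℤ) : ℝ) : ℂ) := by
      rw [← hconj, hab]
      simp [ωE]
      linear_combination (-b ^ 2 : ℂ) * ωc_sq
    exact_mod_cast this
  have hpos : 0 < Nm p := by
    unfold Nm
    rw [Complex.normSq_pos]
    intro h
    exact hp.ne_zero (Subtype.ext h)
  have hne : Nm p ≠ 1 := by
    intro h
    apply hp.not_isUnit
    refine IsUnit.of_mul_eq_one ((a : Eis) + b * (-1 - ωE)) (Subtype.ext ?_)
    rw [h] at hconj
    simpa using hconj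
  rw [hN] at hpos hne ⊢
  norm_cast at hpos hne ⊢
  lia

lemma one_lt_rpow_aux (q : ℝ) (hq : 1 < q) : 1 < q ^ ((3:ℝ)/2) :=
  Real.one_lt_rpow hq (by norm_num)

lemma termwise (q : ℝ) (hq : 1 < q) :
    ((q - 1) * (q + 1) * (q ^ 4 + 2 * q ^ 3 + q ^ 2 - 2 * q ^ ((3:ℝ)/2) + 1) /
          (q * (q ^ ((5:ℝ)/2) + q ^ ((3:ℝ)/2) - 1) ^ 2)) *
        (1 + q / ((q + 1) * (q ^ ((3:ℝ)/2) - 1))) ^ 2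
        = 1 - 1 / (q * (q + 1)) + 2 * q / ((q + 1) * (q ^ ((3:ℝ)/2) - 1)) := by
  have h0 : 0 < q := by linarith
  have h1 := one_lt_rpow_aux q hq
  have h5 : q ^ ((5:ℝ)/2) = q * q ^ ((3:ℝ)/2) := by
    rw [show (5:ℝ)/2 = 1 + 3/2 by norm_num, Real.rpow_add h0, Real.rpow_one]
  have hs : (q ^ ((3:ℝ)/2)) ^ 2 = q ^ 3 := by
    rw [← Real.rpow_natCast, ← Real.rpow_mul h0.le, ← Real.rpow_natCast]
    norm_num
  rw [h5]
  generalize q ^ ((3:ℝ)/2) = t at *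
  have ht : t - 1 ≠ 0 := by linarith
  have hq0 : q ≠ 0 := h0.ne'
  have hq1 : q + 1 ≠ 0 := by linarith
  have hD : q * t + t - 1 ≠ 0 := by nlinarith
  have e1 : 1 + q / ((q + 1) * (t - 1)) = (q * t + t - 1) / ((q + 1) * (t - 1)) := by
    field_simp; ring
  have e2 : 1 - 1 / (q * (q + 1)) + 2 * q / ((q + 1) * (t - 1))
      = ((q ^ 2 + q - 1) * (t - 1) + 2 * q ^ 2) / (q * (q + 1) * (t - 1)) := by
    field_simp
  have e3 : (q - 1) * (q ^ 4 + 2 * q ^ 3 + q ^ 2 - 2 * t + 1)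
      = (t - 1) * ((q ^ 2 + q - 1) * (t - 1) + 2 * q ^ 2) := by
    linear_combination (-(q ^ 2 + q - 1)) * hs
  rw [e1, e2, div_pow, div_mul_div_comm, div_eq_div_iff (by positivity) (by positivity)]
  linear_combination (q + 1) * (q * t + t - 1) ^ 2 * (q * (q + 1) * (t - 1)) * e3

/-- the identity `𝒫₁ = 1` of Section 8: a termwise identity at each
real `q > 1`, and consequently the Euler product over the prime ideals `𝔭 ∤ 3` of `ℤ[ω]`
equals `1`. -/
theorem remarkable_identity_P1 :
    (∀ q : ℝ, 1 < q →
      ((q - 1) * (q + 1) * (q ^ 4 + 2 * q ^ 3 + q ^ 2 - 2 * q ^ ((3:ℝ)/2) + 1) /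
          (q * (q ^ ((5:ℝ)/2) + q ^ ((3:ℝ)/2) - 1) ^ 2)) *
        (1 + q / ((q + 1) * (q ^ ((3:ℝ)/2) - 1))) ^ 2
        = 1 - 1 / (q * (q + 1)) + 2 * q / ((q + 1) * (q ^ ((3:ℝ)/2) - 1))) ∧
    primeProd P1factor = 1 := by
  refine ⟨termwise, ?_⟩
  unfold primeProd
  have key : ∀ π : {p : Eis // Prime p ∧ (3 : Eis) ∣ (p - 1)}, P1factor (Nm π.1) = 1 := by
    intro π
    have hq := Nm_gt_one π.1 π.2.1
    generalize Nm π.1 = q at hq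
    unfold P1factor
    rw [termwise q hq]
    apply mul_inv_cancel₀
    have h1 := one_lt_rpow_aux q hq
    have h2 : 0 < 2 * q / ((q + 1) * (q ^ ((3:ℝ)/2) - 1)) :=
      div_pos (by linarith) (mul_pos (by linarith) (by linarith))
    have h3 : 1 / (q * (q + 1)) < 1 := by
      rw [div_lt_one (by nlinarith)]
      nlinarith
    linarith
  simp only [key, tprod_one]

end CubicPaper
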